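/- (Deterministic core of the Forest Lasso theorem.) Let F : ℝ^d → ℝ be convex and differentiable, let ν₀ ∈ ℝ^d be k-sparse with support S (so |S| ≤ k), let λ > 0 satisfy λ ≥ 2‖∇F(ν₀)‖_∞, and let ν̂ be a global minimizer of ν ↦ F(ν) + λ‖ν‖₁. Suppose F satisfies restricted strong convexity with constant γ̂ > 0 over the cone C(S;3): for every ρ ∈ C(S;3), F(ν₀ + ρ) − F(ν₀) − ⟨∇F(ν₀), ρ⟩ ≥ γ̂ ‖ρ‖₂². Then ‖ν̂ − ν₀‖₂ ≤ 3λ√k/(2γ̂) and ‖ν̂ − ν₀‖₁ ≤ 6λk/γ̂. -/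

import Mathlib

/-- A convex function lies above its tangent hyperplanes. -/
theorem ConvexOn.add_fderiv_le {E : Type*} [NormedAddCommGroup E] [NormedSpace ℝ E] {F : E → ℝ}
    (hF : ConvexOn ℝ Set.univ F) {x : E} (hx : DifferentiableAt ℝ F x) (y : E) :
    F x + fderiv ℝ F x (y - x) ≤ F y := by
  have hconv : ConvexOn ℝ Set.univ (F ∘ AffineMap.lineMap x y) :=
    hF.comp_affineMap (AffineMap.lineMap x y : ℝ →ᵃ[ℝ] E)
  have hderiv : HasDerivAt (F ∘ AffineMap.lineMap x y) (fderiv ℝ F x (y - x)) (0 : ℝ) := by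
    refine HasFDerivAt.comp_hasDerivAt (0 : ℝ) ?_ AffineMap.hasDerivAt_lineMap
    simpa using hx.hasFDerivAt
  have h := hconv.le_slope_of_hasDerivAt (Set.mem_univ 0) (Set.mem_univ 1) zero_lt_one hderiv
  simp only [slope_def_field, Function.comp_apply, AffineMap.lineMap_apply_zero,
    AffineMap.lineMap_apply_one, sub_zero, div_one] at h
  linarith

/-- Hölder's inequality between `ℓ¹` and `ℓ^∞` for a linear functional on `ℝ^ι`. -/
theorem ContinuousLinearMap.abs_apply_le_mul_sum_abs {ι : Type*} [Fintype ι] [DecidableEq ι]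
    (L : (ι → ℝ) →L[ℝ] ℝ) {c : ℝ} (hL : ∀ i, |L (Pi.single i 1)| ≤ c) (x : ι → ℝ) :
    |L x| ≤ c * ∑ i, |x i| := by
  have hx : L x = ∑ i, x i * L (Pi.single i 1) := by
    conv_lhs => rw [pi_eq_sum_univ' x]
    simp
  rw [hx, Finset.mul_sum]
  refine (Finset.abs_sum_le_sum_abs _ _).trans (Finset.sum_le_sum fun i _ => ?_)
  rw [abs_mul, mul_comm]
  gcongr
  exact hL i

/-- If `x` vanishes off `S`, perturbing `x` to `y` decreases the `ℓ¹` norm by at most the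
`ℓ¹` norm of `y - x` on `S` minus that off `S`. -/
theorem sum_abs_sub_sum_abs_le {ι : Type*} [Fintype ι] [DecidableEq ι] (S : Finset ι)
    (x y : ι → ℝ) (hx : ∀ i ∉ S, x i = 0) :
    ∑ i, |x i| - ∑ i, |y i| ≤ ∑ i ∈ S, |y i - x i| - ∑ i ∈ Sᶜ, |y i - x i| := by
  rw [← Finset.sum_sub_distrib, ← Finset.sum_add_sum_compl S, sub_eq_add_neg,
    ← Finset.sum_neg_distrib]
  refine add_le_add (Finset.sum_le_sum fun i _ => ?_) (Finset.sum_le_sum fun i hi => ?_)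
  · rw [abs_sub_comm (y i)]
    exact abs_sub_abs_le_abs_sub _ _
  · simp [hx i (Finset.mem_compl.mp hi)]

/-- Cauchy–Schwarz for the `ℓ¹` norm on a set of at most `k` coordinates. -/
theorem sum_abs_le_sqrt_mul_sqrt {ι : Type*} [Fintype ι] (S : Finset ι) {k : ℕ}
    (hk : S.card ≤ k) (x : ι → ℝ) :
    ∑ i ∈ S, |x i| ≤ √k * √(∑ i, x i ^ 2) := by
  rw [← Real.sqrt_mul (Nat.cast_nonneg k)]
  apply Real.le_sqrt_of_sq_le
  calc (∑ i ∈ S, |x i|) ^ 2 ≤ S.card * ∑ i ∈ S, |x i| ^ 2 := sq_sum_le_card_mul_sum_sq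
    _ ≤ k * ∑ i, x i ^ 2 := by
      simp only [sq_abs]
      gcongr
      exact Finset.subset_univ S

/-- deterministic core of the Forest Lasso theorem: under convexity,
    `λ ≥ 2‖∇F(v0)‖_∞`, global minimality of `vhat` for the `ℓ¹`-penalized objective, and
    restricted strong convexity with constant `γ̂` over the cone `C(S;3)` where `S` is the
    support of the `k`-sparse `v0`, we have `‖vhat − v0‖₂ ≤ 3λ√k/(2γ̂)` and
    `‖vhat − v0‖₁ ≤ 6λk/γ̂`. -/
theorem stmt_3 (d k : ℕ) (F : (Fin d → ℝ) → ℝ)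
    (hconv : ConvexOn ℝ Set.univ F) (hdiff : Differentiable ℝ F)
    (v0 vhat : Fin d → ℝ) (S : Finset (Fin d)) (hS : ∀ i, i ∈ S ↔ v0 i ≠ 0)
    (hk : S.card ≤ k)
    (lam gam : ℝ) (hlam_pos : 0 < lam) (hgam : 0 < gam)
    (hlam : ∀ i, 2 * |fderiv ℝ F v0 (Pi.single i 1)| ≤ lam)
    (hmin : ∀ ν, F vhat + lam * ∑ i, |vhat i| ≤ F ν + lam * ∑ i, |ν i|)
    (hrsc : ∀ ρ : Fin d → ℝ, (∑ i ∈ Sᶜ, |ρ i| ≤ 3 * ∑ i ∈ S, |ρ i|) →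
      gam * ∑ i, (ρ i) ^ 2 ≤ F (v0 + ρ) - F v0 - fderiv ℝ F v0 ρ) :
    Real.sqrt (∑ i, (vhat i - v0 i) ^ 2) ≤ 3 * lam * Real.sqrt k / (2 * gam) ∧
      ∑ i, |vhat i - v0 i| ≤ 6 * lam * k / gam := by
  have hgrad := hconv.add_fderiv_le (hdiff v0) vhat
  have hdual := (fderiv ℝ F v0).abs_apply_le_mul_sum_abs (c := lam / 2)
    (fun i => by linarith [hlam i]) (vhat - v0)
  have hpen := mul_le_mul_of_nonneg_left (sum_abs_sub_sum_abs_le S v0 vhat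
    fun i hi => not_not.mp fun h => hi ((hS i).mpr h)) hlam_pos.le
  have hmin0 := hmin v0
  have hrsc0 := hrsc (vhat - v0)
  have hcs := sum_abs_le_sqrt_mul_sqrt S hk (vhat - v0)
  have hsplit := Finset.sum_add_sum_compl S fun i => |vhat i - v0 i|
  simp only [Pi.sub_apply, add_sub_cancel] at hdual hrsc0 hcs
  have hQ : 0 ≤ ∑ i, (vhat i - v0 i) ^ 2 := Finset.sum_nonneg fun i _ => sq_nonneg _
  have hb : 0 ≤ ∑ i ∈ Sᶜ, |vhat i - v0 i| := Finset.sum_nonneg fun i _ => abs_nonneg _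
  rw [← hsplit] at hdual ⊢
  set a := ∑ i ∈ S, |vhat i - v0 i|
  set b := ∑ i ∈ Sᶜ, |vhat i - v0 i|
  set Q := ∑ i, (vhat i - v0 i) ^ 2
  have hlower := (abs_le.mp hdual).1
  have hcone : b ≤ 3 * a := by
    refine le_of_mul_le_mul_left ?_ hlam_pos
    linarith
  have hbound : gam * (√Q * √Q) ≤ 3 / 2 * lam * (√k * √Q) := by
    rw [Real.mul_self_sqrt hQ]
    linarith [hrsc0 hcone, mul_nonneg hlam_pos.le hb, mul_le_mul_of_nonneg_left hcs hlam_pos.le]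
  have hl2 : √Q ≤ 3 * lam * √k / (2 * gam) := by
    rw [le_div_iff₀ (by positivity)]
    rcases (Real.sqrt_nonneg Q).eq_or_lt with h0 | hpos
    · rw [← h0, zero_mul]
      positivity
    · refine le_of_mul_le_mul_right ?_ hpos
      linarith
  refine ⟨hl2, ?_⟩
  calc a + b ≤ 4 * (√k * √Q) := by linarith
    _ ≤ 4 * (√k * (3 * lam * √k / (2 * gam))) := by gcongr
    _ = 6 * lam * (√k * √k) / gam := by
      field_simp
      ring
    _ = 6 * lam * k / gam := by rw [Real.mul_self_sqrt (Nat.cast_nonneg k)]
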